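/- For every j ≥ 0, a complex number λ is an eigenvalue of the finite generalized Jacobi matrix H_{[0,j]} if and only if P_{j+1}(λ) = 0; and for every j ≥ 1, λ is an eigenvalue of H_{[1,j]} if and only if Q_{j+1}(λ) = 0. -/

import Mathlib

open Polynomial

/-- Polynomials of the first kind: `P_0 = 1`, `P_1 = p_0 / b_0`, and
`b_{j+1} P_{j+2} = p_{j+1} P_{j+1} - ε_j ε_{j+1} b_j P_j`. -/
noncomputable def genP (ε b : ℕ → ℝ) (p : ℕ → Polynomial ℝ) : ℕ → Polynomial ℝ
  | 0 => 1
  | 1 => Polynomial.C (b 0)⁻¹ * p 0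
  | (j + 2) => Polynomial.C (b (j + 1))⁻¹ *
      (p (j + 1) * genP ε b p (j + 1) -
        Polynomial.C (ε j * ε (j + 1) * b j) * genP ε b p j)

/-- Polynomials of the second kind: `Q_0 = 0`, `Q_1 = ε_0 / b_0`, same recurrence. -/
noncomputable def genQ (ε b : ℕ → ℝ) (p : ℕ → Polynomial ℝ) : ℕ → Polynomial ℝ
  | 0 => 0
  | 1 => Polynomial.C (ε 0 / b 0)
  | (j + 2) => Polynomial.C (b (j + 1))⁻¹ *
      (p (j + 1) * genQ ε b p (j + 1) -
        Polynomial.C (ε j * ε (j + 1) * b j) * genQ ε b p j)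

/-- `nsum k j = n_j = k_0 + ⋯ + k_{j-1}`. -/
def nsum (k : ℕ → ℕ) (j : ℕ) : ℕ := ∑ i ∈ Finset.range j, k i

/-- The index `i` of the block containing the global row/column index `r`,
i.e. the greatest `i` with `n_i ≤ r` (assuming all `k i ≥ 1`). -/
def blkIdx (k : ℕ → ℕ) (r : ℕ) : ℕ := Nat.findGreatest (fun i => nsum k i ≤ r) r

/-- Entry of the (infinite) generalized Jacobi matrix at global position `(r, c)`:
diagonal blocks are companion matrices `C_{p_i}`, subdiagonal blocks `B_i` have the
single nonzero entry `b_i` in the top-right corner, superdiagonal blocks `B̃_i` have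
the single nonzero entry `ε_i ε_{i+1} b_i` in the top-right corner. -/
noncomputable def Jentry (ε b : ℕ → ℝ) (p : ℕ → Polynomial ℝ) (k : ℕ → ℕ) (r c : ℕ) : ℝ :=
  let i := blkIdx k r
  let i' := blkIdx k c
  let a := r - nsum k i
  let a' := c - nsum k i'
  if i = i' then
    (if a' = k i - 1 then -((p i).coeff a) else if a = a' + 1 then 1 else 0)
  else if i = i' + 1 then
    (if a = 0 ∧ a' = k i' - 1 then b i' else 0)
  else if i' = i + 1 then
    (if a = 0 ∧ a' = k i' - 1 then ε i * ε i' * b i else 0)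
  else 0

/-- The finite generalized Jacobi matrix built from the blocks indexed `0, …, m-1`;
it has size `n_m × n_m`.  Thus `H_{[0,j]} = JmatN ε b p k (j+1)`. -/
noncomputable def JmatN (ε b : ℕ → ℝ) (p : ℕ → Polynomial ℝ) (k : ℕ → ℕ) (m : ℕ) :
    Matrix (Fin (nsum k m)) (Fin (nsum k m)) ℝ :=
  Matrix.of fun r c => Jentry ε b p k (r : ℕ) (c : ℕ)

lemma nsum_succ (k : ℕ → ℕ) (i : ℕ) : nsum k (i + 1) = nsum k i + k i :=
  Finset.sum_range_succ _ _

lemma nsum_mono (k : ℕ → ℕ) : Monotone (nsum k) :=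
  monotone_nat_of_le_succ fun i => by simp [nsum_succ]

lemma le_nsum {k : ℕ → ℕ} (hk : ∀ j, 1 ≤ k j) (i : ℕ) : i ≤ nsum k i := by
  induction i with
  | zero => simp
  | succ i ih => have := hk i; rw [nsum_succ]; omega

lemma blkIdx_nsum_add {k : ℕ → ℕ} (hk : ∀ j, 1 ≤ k j) {i a : ℕ} (ha : a < k i) :
    blkIdx k (nsum k i + a) = i := by
  rw [blkIdx, Nat.findGreatest_eq_iff]
  refine ⟨(le_nsum hk i).trans (Nat.le_add_right _ _), fun _ => Nat.le_add_right _ _, ?_⟩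
  intro n hn _ hle
  have := nsum_mono k (Nat.succ_le_of_lt hn)
  rw [Nat.succ_eq_add_one, nsum_succ] at this
  omega

lemma exists_eq_nsum_add {k : ℕ → ℕ} {m r : ℕ} (hr : r < nsum k m) :
    ∃ i < m, ∃ a < k i, r = nsum k i + a := by
  induction m with
  | zero => simp [nsum] at hr
  | succ m ih =>
    rcases lt_or_ge r (nsum k m) with h | h
    · obtain ⟨i, hi, a, ha, rfl⟩ := ih h
      exact ⟨i, by omega, a, ha, rfl⟩
    · rw [nsum_succ] at hr
      exact ⟨m, by omega, r - nsum k m, by omega, by omega⟩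

lemma nsum_add_lt {k : ℕ → ℕ} {m i a : ℕ} (hi : i < m) (ha : a < k i) :
    nsum k i + a < nsum k m := by
  have := nsum_mono k (Nat.succ_le_of_lt hi)
  rw [Nat.succ_eq_add_one, nsum_succ] at this
  omega

lemma sum_range_nsum {M : Type*} [AddCommMonoid M] (k : ℕ → ℕ) (m : ℕ) (f : ℕ → M) :
    ∑ r ∈ Finset.range (nsum k m), f r =
      ∑ i ∈ Finset.range m, ∑ a ∈ Finset.range (k i), f (nsum k i + a) := by
  induction m with
  | zero => simp [nsum]
  | succ m ih => rw [nsum_succ, Finset.sum_range_add, ih, Finset.sum_range_succ]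

section

variable (ε b : ℕ → ℝ) (p : ℕ → Polynomial ℝ) (k : ℕ → ℕ)

lemma Jentry_nsum_add {k : ℕ → ℕ} (hk : ∀ j, 1 ≤ k j) {i a i' a' : ℕ}
    (ha : a < k i) (ha' : a' < k i') :
    Jentry ε b p k (nsum k i + a) (nsum k i' + a') =
      if i = i' then
        (if a' = k i - 1 then -((p i).coeff a) else if a = a' + 1 then 1 else 0)
      else if i = i' + 1 then (if a = 0 ∧ a' = k i' - 1 then b i' else 0)
      else if i' = i + 1 then (if a = 0 ∧ a' = k i' - 1 then ε i * ε i' * b i else 0)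
      else 0 := by
  simp only [Jentry, blkIdx_nsum_add hk ha, blkIdx_nsum_add hk ha', Nat.add_sub_cancel_left]

/-- A non-final column of a diagonal block of the generalized Jacobi matrix is a shift. -/
lemma sum_mul_Jentry_of_lt {k : ℕ → ℕ} (hk : ∀ j, 1 ≤ k j) {m i a : ℕ} (hi : i < m)
    (ha : a + 1 < k i) (W : ℕ → ℂ) :
    ∑ r ∈ Finset.range (nsum k m), W r * (Jentry ε b p k r (nsum k i + a) : ℂ) =
      W (nsum k i + (a + 1)) := by
  rw [sum_range_nsum, Finset.sum_eq_single_of_mem i (Finset.mem_range.2 hi),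
    Finset.sum_eq_single_of_mem (a + 1) (Finset.mem_range.2 ha)]
  · rw [Jentry_nsum_add ε b p hk ha (by omega), if_pos rfl, if_neg (by omega), if_pos rfl]
    simp
  · intro x hx hne
    rw [Jentry_nsum_add ε b p hk (Finset.mem_range.1 hx) (by omega), if_pos rfl,
      if_neg (by omega), if_neg hne]
    simp
  · intro l _ hne
    refine Finset.sum_eq_zero fun x hx => ?_
    rw [Jentry_nsum_add ε b p hk (Finset.mem_range.1 hx) (by omega), if_neg hne,
      if_neg (by omega : ¬ (x = 0 ∧ a = k i - 1)), if_neg (by omega : ¬ (x = 0 ∧ a = k i - 1))]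
    simp

/-- The contribution of the superdiagonal block above the `i`-th diagonal block. -/
noncomputable def superTerm (u : ℕ → ℂ) : ℕ → ℂ
  | 0 => 0
  | i + 1 => (ε i * ε (i + 1) * b i : ℝ) * u i

/-- The final column of a diagonal block of the generalized Jacobi matrix. -/
lemma sum_mul_Jentry_last {k : ℕ → ℕ} (hk : ∀ j, 1 ≤ k j) {m i : ℕ} (hi : i < m)
    (W : ℕ → ℂ) (hW : W (nsum k m) = 0) :
    ∑ r ∈ Finset.range (nsum k m), W r * (Jentry ε b p k r (nsum k i + (k i - 1)) : ℂ) =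
      -(∑ a ∈ Finset.range (k i), ((p i).coeff a : ℂ) * W (nsum k i + a)) +
        b i * W (nsum k (i + 1)) + superTerm ε b (fun l => W (nsum k l)) i := by
  have hki := hk i
  have block : ∀ l, ∑ a ∈ Finset.range (k l),
      W (nsum k l + a) * (Jentry ε b p k (nsum k l + a) (nsum k i + (k i - 1)) : ℂ) =
      (if l = i then -(∑ a ∈ Finset.range (k i), ((p i).coeff a : ℂ) * W (nsum k i + a)) else 0)
      + (if l = i + 1 then b i * W (nsum k (i + 1)) else 0)
      + (if i = l + 1 then ((ε l * ε i * b l : ℝ) : ℂ) * W (nsum k l) else 0) := by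
    intro l
    have hkl := hk l
    have entry := fun a (ha : a ∈ Finset.range (k l)) =>
      Jentry_nsum_add ε b p hk (Finset.mem_range.1 ha) (show k i - 1 < k i by omega)
    by_cases h₁ : l = i
    · subst h₁
      rw [if_pos rfl, if_neg (by omega), if_neg (by omega), add_zero, add_zero,
        ← Finset.sum_neg_distrib]
      refine Finset.sum_congr rfl fun a ha => ?_
      rw [entry a ha, if_pos rfl, if_pos rfl]
      push_cast
      ring
    rw [if_neg h₁, zero_add, Finset.sum_eq_single_of_mem 0 (Finset.mem_range.2 hkl)]
    · rw [entry 0 (Finset.mem_range.2 hkl), if_neg h₁]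
      by_cases h₂ : l = i + 1
      · have h₃ : i ≠ l + 1 := by omega
        simp only [if_neg h₃, and_self, if_true, add_zero, ← h₂]
        exact mul_comm _ _
      · by_cases h₃ : i = l + 1
        · simp only [if_neg h₂, if_pos h₃, and_self, if_true, add_zero, zero_add]
          exact mul_comm _ _
        · simp [h₂, h₃]
    · intro a ha hne
      rw [entry a ha, if_neg h₁]
      simp [hne]
  rw [sum_range_nsum, Finset.sum_congr rfl fun l _ => block l, Finset.sum_add_distrib,
    Finset.sum_add_distrib, Finset.sum_ite_eq', Finset.sum_ite_eq', if_pos (Finset.mem_range.2 hi)]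
  congr 1
  · congr 1
    split_ifs with h
    · rfl
    · rw [show i + 1 = m by rw [Finset.mem_range] at h; omega, hW, mul_zero]
  · cases i with
    | zero => simp [superTerm]
    | succ i =>
      simp only [add_left_inj]
      rw [Finset.sum_ite_eq, if_pos (Finset.mem_range.2 (by omega))]
      rfl

lemma aeval_genP_succ {b : ℕ → ℝ} (hb : ∀ j, b j ≠ 0) (z : ℂ) (i : ℕ) :
    b i * aeval z (genP ε b p (i + 1)) + superTerm ε b (fun l => aeval z (genP ε b p l)) i =
      aeval z (p i) * aeval z (genP ε b p i) := by
  have h : (b i : ℂ) ≠ 0 := by exact_mod_cast hb i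
  cases i with
  | zero => simp [genP, superTerm, h]
  | succ i =>
    simp only [genP, superTerm, map_mul, map_sub, aeval_C, Complex.coe_algebraMap,
      Complex.ofReal_inv, mul_inv_cancel_left₀ h, Complex.ofReal_mul]
    ring

lemma eq_mul_aeval_genP {b : ℕ → ℝ} (hb : ∀ j, b j ≠ 0) (z : ℂ) (u : ℕ → ℂ) (m : ℕ)
    (hu : ∀ i < m, b i * u (i + 1) + superTerm ε b u i = aeval z (p i) * u i) :
    ∀ i ≤ m, u i = u 0 * aeval z (genP ε b p i) := by
  intro i
  induction i using Nat.strong_induction_on with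
  | _ i ih =>
    intro hi
    cases i with
    | zero => simp [genP]
    | succ i =>
      have h : (b i : ℂ) ≠ 0 := by exact_mod_cast hb i
      have h₁ := hu i hi
      have h₂ := aeval_genP_succ ε p hb z i
      have h₃ := ih i (by omega) (by omega)
      have h₄ : superTerm ε b u i =
          u 0 * superTerm ε b (fun l => aeval z (genP ε b p l)) i := by
        cases i with
        | zero => simp [superTerm]
        | succ i =>
          simp only [superTerm]
          rw [ih i (by omega) (by omega)]
          ring
      apply mul_left_cancel₀ h
      linear_combination h₁ - u 0 * h₂ - h₄ + aeval z (p i) * h₃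

lemma aeval_eq_of_monic {q : ℝ[X]} (hq : q.Monic) (z : ℂ) :
    aeval z q = ∑ a ∈ Finset.range q.natDegree, (q.coeff a : ℂ) * z ^ a + z ^ q.natDegree := by
  rw [aeval_eq_sum_range, Finset.sum_range_succ, hq.coeff_natDegree, one_smul]
  simp [Algebra.smul_def]

lemma mem_spectrum_map_JmatN_iff (m : ℕ) (z : ℂ) :
    z ∈ spectrum ℂ ((JmatN ε b p k m).map (algebraMap ℝ ℂ)) ↔
      ∃ w : Fin (nsum k m) → ℂ, w ≠ 0 ∧
        ∀ c : Fin (nsum k m), ∑ r : Fin (nsum k m), w r * (Jentry ε b p k (r : ℕ) (c : ℕ) : ℂ) = z * w c := by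
  rw [spectrum.mem_iff, Matrix.isUnit_iff_isUnit_det, isUnit_iff_ne_zero, not_not,
    ← Matrix.exists_vecMul_eq_zero_iff]
  refine exists_congr fun w => and_congr_right fun _ => ?_
  rw [Matrix.vecMul_sub, sub_eq_zero, funext_iff]
  refine forall_congr' fun c => ?_
  rw [Algebra.algebraMap_eq_smul_one, Matrix.vecMul_smul, Matrix.vecMul_one, eq_comm]
  rfl

variable {b p k}

theorem mem_spectrum_JmatN_iff (hb : ∀ j, b j ≠ 0)
    (hp : ∀ j, (p j).Monic) (hdeg : ∀ j, (p j).natDegree = k j) (hk : ∀ j, 1 ≤ k j)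
    {m : ℕ} (hm : 1 ≤ m) (z : ℂ) :
    z ∈ spectrum ℂ ((JmatN ε b p k m).map (algebraMap ℝ ℂ)) ↔
      aeval z (genP ε b p m) = 0 := by
  have hp' : ∀ i, aeval z (p i) =
      ∑ a ∈ Finset.range (k i), ((p i).coeff a : ℂ) * z ^ a + z ^ k i := fun i => by
    rw [aeval_eq_of_monic (hp i), hdeg]
  have hpow : ∀ i, z * z ^ (k i - 1) = z ^ k i := fun i => mul_pow_sub_one (Nat.one_le_iff_ne_zero.1 (hk i)) z
  have hsum : ∀ (W : ℕ → ℂ) (i : ℕ),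
      (∀ a < k i, W (nsum k i + a) = z ^ a * W (nsum k i)) →
      ∑ a ∈ Finset.range (k i), ((p i).coeff a : ℂ) * W (nsum k i + a) =
        (∑ a ∈ Finset.range (k i), ((p i).coeff a : ℂ) * z ^ a) * W (nsum k i) := by
    intro W i h
    rw [Finset.sum_mul]
    exact Finset.sum_congr rfl fun a ha => by rw [h a (Finset.mem_range.1 ha), mul_assoc]
  rw [mem_spectrum_map_JmatN_iff]
  constructor
  · rintro ⟨w, hw, h⟩
    set W : ℕ → ℂ := fun r => if h : r < nsum k m then w ⟨r, h⟩ else 0 with hWdef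
    have hWval : ∀ r : Fin (nsum k m), W r = w r := fun r => by simp [hWdef]
    have hWm : W (nsum k m) = 0 := by simp [hWdef]
    have hW : ∀ c < nsum k m,
        ∑ r ∈ Finset.range (nsum k m), W r * (Jentry ε b p k r c : ℂ) = z * W c := by
      intro c hc
      rw [Finset.sum_range, hWval ⟨c, hc⟩, ← h ⟨c, hc⟩]
      exact Finset.sum_congr rfl fun r _ => by rw [hWval]
    have hshift : ∀ i < m, ∀ a < k i, W (nsum k i + a) = z ^ a * W (nsum k i) := by
      intro i hi a
      induction a with
      | zero => simp
      | succ a ih =>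
        intro ha
        rw [← sum_mul_Jentry_of_lt ε b p hk hi ha W, hW _ (nsum_add_lt hi (by omega)),
          ih (by omega)]
        ring
    have hrec := eq_mul_aeval_genP ε p hb z (fun i => W (nsum k i)) m (by
      intro i hi
      have hki := hk i
      have h₁ := sum_mul_Jentry_last ε b p hk hi W hWm
      rw [hW _ (nsum_add_lt hi (by omega)), hshift i hi _ (by omega),
        hsum W i (hshift i hi)] at h₁
      linear_combination -h₁ + W (nsum k i) * (hpow i - hp' i))
    have h₀ : W (nsum k 0) ≠ 0 := by
      intro h₀
      apply hw
      funext r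
      obtain ⟨i, hi, a, ha, hr⟩ := exists_eq_nsum_add r.2
      rw [← hWval, hr, hshift i hi a ha, hrec i hi.le, h₀]
      simp
    have h₁ := hrec m le_rfl
    rw [hWm, eq_comm, mul_eq_zero] at h₁
    exact h₁.resolve_left h₀
  · intro h
    set W : ℕ → ℂ := fun r =>
      z ^ (r - nsum k (blkIdx k r)) * aeval z (genP ε b p (blkIdx k r)) with hWdef
    have hWval : ∀ i, ∀ a < k i, W (nsum k i + a) = z ^ a * aeval z (genP ε b p i) := by
      intro i a ha
      simp only [hWdef, blkIdx_nsum_add hk ha, Nat.add_sub_cancel_left]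
    have hW₀ : ∀ i, W (nsum k i) = aeval z (genP ε b p i) := fun i => by
      simpa using hWval i 0 (hk i)
    have hshift : ∀ i, ∀ a < k i, W (nsum k i + a) = z ^ a * W (nsum k i) := by
      intro i a ha
      rw [hWval i a ha, hW₀]
    refine ⟨fun r => W r, fun h₀ => ?_, fun c => ?_⟩
    · have h₁ : W (nsum k 0 + 0) = 0 := congrFun h₀ ⟨_, nsum_add_lt hm (hk 0)⟩
      simp [hW₀, genP] at h₁
    · change _ = z * W c
      rw [← Finset.sum_range fun r => W r * (Jentry ε b p k r c : ℂ)]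
      obtain ⟨i, hi, a, ha, hc⟩ := exists_eq_nsum_add c.2
      rw [hc]
      rcases Nat.lt_or_ge (a + 1) (k i) with ha' | ha'
      · rw [sum_mul_Jentry_of_lt ε b p hk hi ha', hshift i _ ha', hshift i a ha]
        ring
      · obtain rfl : a = k i - 1 := by omega
        rw [sum_mul_Jentry_last ε b p hk hi W ((hW₀ m).trans h), hshift i _ ha,
          hsum W i (hshift i)]
        have h₁ := aeval_genP_succ ε p hb z i
        simp only [hW₀]
        linear_combination h₁ + aeval z (genP ε b p i) * (hp' i - hpow i)

end

lemma genQ_succ (ε b : ℕ → ℝ) (p : ℕ → Polynomial ℝ) : ∀ j,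
    genQ ε b p (j + 1) = C (ε 0 / b 0) *
      genP (fun i => ε (i + 1)) (fun i => b (i + 1)) (fun i => p (i + 1)) j
  | 0 => by simp [genQ, genP]
  | 1 => by simp only [genQ, genP]; ring
  | j + 2 => by
    rw [genQ, genQ_succ ε b p (j + 1), genQ_succ ε b p j, genP]
    ring

/-- For every `j ≥ 0`, `λ ∈ ℂ` is an eigenvalue of `H_{[0,j]}` iff `P_{j+1}(λ) = 0`;
for every `j ≥ 1`, `λ` is an eigenvalue of `H_{[1,j]}` (built from the data indexed
`1, …, j`) iff `Q_{j+1}(λ) = 0`. -/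
theorem eigenvalues_iff_root (ε b : ℕ → ℝ) (p : ℕ → Polynomial ℝ) (k : ℕ → ℕ)
    (hε : ∀ j, ε j = 1 ∨ ε j = -1) (hb : ∀ j, 0 < b j)
    (hp : ∀ j, (p j).Monic) (hdeg : ∀ j, (p j).natDegree = k j) (hk : ∀ j, 1 ≤ k j) :
    (∀ (j : ℕ) (z : ℂ),
      z ∈ spectrum ℂ ((JmatN ε b p k (j + 1)).map (algebraMap ℝ ℂ)) ↔
        Polynomial.aeval z (genP ε b p (j + 1)) = 0) ∧
    (∀ (j : ℕ), 1 ≤ j → ∀ z : ℂ,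
      z ∈ spectrum ℂ ((JmatN (fun i => ε (i + 1)) (fun i => b (i + 1))
          (fun i => p (i + 1)) (fun i => k (i + 1)) j).map (algebraMap ℝ ℂ)) ↔
        Polynomial.aeval z (genQ ε b p (j + 1)) = 0) := by
  have hb' : ∀ j, b j ≠ 0 := fun j => (hb j).ne'
  refine ⟨fun j z => mem_spectrum_JmatN_iff ε hb' hp hdeg hk (Nat.le_add_left 1 j) z,
    fun j hj z => ?_⟩
  have hc : ((ε 0 / b 0 : ℝ) : ℂ) ≠ 0 := by
    have : ε 0 ≠ 0 := by rcases hε 0 with h | h <;> simp [h]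
    exact_mod_cast div_ne_zero this (hb' 0)
  rw [genQ_succ ε b p j, map_mul, aeval_C, Complex.coe_algebraMap, mul_eq_zero,
    or_iff_right hc]
  exact mem_spectrum_JmatN_iff _ (fun j => hb' (j + 1)) (fun j => hp (j + 1))
    (fun j => hdeg (j + 1)) (fun j => hk (j + 1)) hj z
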